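/- Let (v,w) be a pair of distinct binary words of the same length having property R. Then (v,w) has odd symmetry: Win(v,w;1−p) = 1 − Win(v,w;p) for all p ∈ (0,1). If in addition ‖v‖₁ = ‖w‖₁, then (v,w) has constant symmetry: Win(v,w;p) = 1/2 for all p ∈ (0,1). -/

import Mathlib

open scoped BigOperators

/-- Bernoulli(p) weight of a binary word `u`: `ℙ_p(u) = p^{‖u‖₁} (1-p)^{‖u‖₀}`. -/
noncomputable def wProb (p : ℝ) (u : List Bool) : ℝ :=
  p ^ (u.count true) * (1 - p) ^ (u.count false)

/-- Number of occurrences of `v` as a contiguous subword of `u`. -/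
def occCount (v u : List Bool) : ℕ :=
  (List.range (u.length + 1)).countP (fun i => decide (v <+: u.drop i))

/-- `Ω_{v,w}(v)`: binary words having `v` as a suffix, containing `v` exactly once
as a subword, and not containing `w` as a subword.  (`Ω_{v,w}(w) = OmegaWin w v`.) -/
def OmegaWin (v w : List Bool) : Set (List Bool) :=
  {u | v <:+ u ∧ occCount v u = 1 ∧ ¬ (w <:+: u)}

/-- The win probability `Win(v,w;p) = ∑_{u ∈ Ω_{v,w}(v)} ℙ_p(u)`. -/
noncomputable def Win (v w : List Bool) (p : ℝ) : ℝ :=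
  ∑' u : OmegaWin v w, wProb p u

/-- The correlation polynomial `vw_p = ∑_{u ∈ O(v,w)} ℙ_p(u)⁻¹`, where `O(v,w)` is
the set of nonempty words that are simultaneously a suffix of `v` and a prefix of `w`. -/
noncomputable def corr (v w : List Bool) (p : ℝ) : ℝ :=
  ∑ i ∈ Finset.Icc 1 w.length,
    if w.take i <:+ v then (wProb p (w.take i))⁻¹ else 0

/-- `Ω*_{v,w}(v) = {x : x ++ v ∈ Ω_{v,w}(v)}` (with `x` possibly empty). -/
def OmegaStarV (v w : List Bool) : Set (List Bool) :=
  {x | x ++ v ∈ OmegaWin v w}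

/-- Property `R`: `Ω*_{v,w}(v) = Ω*_{v,w}(w)`. -/
def PropR (v w : List Bool) : Prop :=
  OmegaStarV v w = {x | x ++ w ∈ OmegaWin w v}

/-- `D(v,w)`: nonempty proper prefixes `v₁⋯v_{n-k}` of `v` (`1 ≤ k ≤ n-1`) such that
`w₁⋯w_k = v_{n-k+1}⋯v_n`. -/
def Dset (v w : List Bool) : Set (List Bool) :=
  {x | ∃ k, 1 ≤ k ∧ k ≤ v.length - 1 ∧ k ≤ w.length ∧
    x = v.take (v.length - k) ∧ w.take k = v.drop (v.length - k)}

/-- `F(v,w) = D(v,v) ∪ D(w,w) ∪ D(w,v) ∪ D(v,w)`. -/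
def Fset (v w : List Bool) : Set (List Bool) :=
  Dset v v ∪ Dset w w ∪ Dset w v ∪ Dset v w

/-- `a^m`: concatenation of `m` copies of the word `a`. -/
def wpow (a : List Bool) (m : ℕ) : List Bool :=
  (List.replicate m a).flatten

lemma occCount_nil {v : List Bool} (hv : v ≠ []) : occCount v [] = 0 := by
  simp [occCount, hv]

lemma occCount_cons (v : List Bool) (a : Bool) (u : List Bool) :
    occCount v (a :: u) = (if v <+: a :: u then 1 else 0) + occCount v u := by
  unfold occCount
  rw [List.length_cons, List.range_succ_eq_map, List.countP_cons, List.countP_map, add_comm]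
  congr 1
  simp

lemma occCount_eq_zero_iff {v : List Bool} (hv : v ≠ []) (u : List Bool) :
    occCount v u = 0 ↔ ¬ v <:+: u := by
  induction u with
  | nil => simp [occCount_nil hv, hv]
  | cons a u ih =>
    rw [occCount_cons, List.infix_cons_iff, not_or, ← ih]
    split_ifs with h <;> simp [h]

lemma occCount_concat {v : List Bool} (hv : v ≠ []) (u : List Bool) (b : Bool) :
    occCount v (u ++ [b]) = occCount v u + if v <:+ u ++ [b] then 1 else 0 := by
  induction u with
  | nil =>
    rw [List.nil_append, occCount_cons, occCount_nil hv, add_comm]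
    congr 1
    have : v <+: [b] ↔ v <:+ [b] := by
      rw [List.prefix_cons_iff, List.suffix_cons_iff]
      simp [hv]
    simp [this]
  | cons a u ih =>
    rw [List.cons_append, occCount_cons, occCount_cons, ih]
    have hp : v <+: a :: (u ++ [b]) ↔ v = a :: (u ++ [b]) ∨ v <+: a :: u := by
      rw [← List.cons_append, List.prefix_concat_iff]
    have hs : v <:+ a :: (u ++ [b]) ↔ v = a :: (u ++ [b]) ∨ v <:+ u ++ [b] :=
      List.suffix_cons_iff
    by_cases h : v = a :: (u ++ [b])
    · have h1 : ¬ v <+: a :: u := fun h' => by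
        have := h'.length_le
        simp [h] at this
      have h2 : ¬ v <:+ u ++ [b] := fun h' => by
        have := h'.length_le
        simp [h] at this
      rw [if_pos (hp.2 (Or.inl h)), if_neg h1, if_neg h2, if_pos (hs.2 (Or.inl h))]
      omega
    · simp only [hp, hs, h, false_or]
      omega

lemma infix_concat_iff_suffix (v u : List Bool) (b : Bool) :
    v <:+: u ++ [b] ↔ v <:+: u ∨ v <:+ u ++ [b] := by
  rw [List.infix_concat_iff, or_comm]

lemma not_suffix_of_suffix {v w : List Bool} (hne : v ≠ w) (hlen : v.length = w.length)
    {u : List Bool} (h : v <:+ u) : ¬ w <:+ u := fun h' =>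
  hne ((List.suffix_of_suffix_length_le h h' hlen.le).eq_of_length hlen)

lemma concat_mem_OmegaWin {v w : List Bool} (hv : v ≠ []) (hne : v ≠ w)
    (hlen : v.length = w.length) (u : List Bool) (b : Bool) :
    u ++ [b] ∈ OmegaWin v w ↔ (¬ v <:+: u ∧ ¬ w <:+: u) ∧ v <:+ u ++ [b] := by
  by_cases h : v <:+ u ++ [b]
  · have h' := not_suffix_of_suffix hne hlen h
    simp only [OmegaWin, Set.mem_ofPred_eq, h, true_and, and_true, occCount_concat hv, if_true,
      infix_concat_iff_suffix, h', or_false, Nat.add_eq_right, occCount_eq_zero_iff hv]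
  · simp [OmegaWin, h]

/-- The words in which neither `v` nor `w` occurs. -/
def avoiding (v w : List Bool) : Set (List Bool) :=
  {u | ¬ v <:+: u ∧ ¬ w <:+: u}

/-- The weight of a word, restricted to the words that end the game between `v` and `w`. -/
noncomputable def stopWeight (v w : List Bool) (p : ℝ) (u : List Bool) : ℝ :=
  (OmegaWin v w).indicator (wProb p) u + (OmegaWin w v).indicator (wProb p) u

lemma wProb_append (p : ℝ) (x y : List Bool) : wProb p (x ++ y) = wProb p x * wProb p y := by
  simp only [wProb, List.count_append, pow_add]
  ring

lemma wProb_pos {p : ℝ} (hp : p ∈ Set.Ioo (0 : ℝ) 1) (u : List Bool) : 0 < wProb p u :=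
  mul_pos (pow_pos hp.1 _) (pow_pos (sub_pos.2 hp.2) _)

lemma avoiding_indicator_concat {v w : List Bool} (hv : v ≠ []) (hw : w ≠ []) (hne : v ≠ w)
    (hlen : v.length = w.length) (p : ℝ) (u : List Bool) (b : Bool) :
    (avoiding v w).indicator (wProb p) (u ++ [b]) + stopWeight v w p (u ++ [b]) =
      (avoiding v w).indicator (wProb p) u * wProb p [b] := by
  classical
  have hA : u ++ [b] ∈ avoiding v w ↔
      u ∈ avoiding v w ∧ ¬ v <:+ u ++ [b] ∧ ¬ w <:+ u ++ [b] := by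
    simp only [avoiding, Set.mem_ofPred_eq, infix_concat_iff_suffix]
    tauto
  have hV := concat_mem_OmegaWin hv hne hlen u b
  have hW := concat_mem_OmegaWin hw hne.symm hlen.symm u b
  rw [and_comm (a := ¬ w <:+: u)] at hW
  change _ ↔ u ∈ avoiding v w ∧ _ at hV hW
  simp only [stopWeight, Set.indicator_apply, hA, hV, hW, wProb_append]
  by_cases hu : u ∈ avoiding v w
  · by_cases h : v <:+ u ++ [b]
    · simp [hu, h, not_suffix_of_suffix hne hlen h]
    · by_cases h' : w <:+ u ++ [b] <;> simp [hu, h, h']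
  · simp [hu]

/-- The finite set of binary words of length `N`. -/
def wordsOfLength : ℕ → Finset (List Bool)
  | 0 => {[]}
  | N + 1 => (wordsOfLength N).image (· ++ [true]) ∪ (wordsOfLength N).image (· ++ [false])

lemma mem_wordsOfLength {N : ℕ} {u : List Bool} : u ∈ wordsOfLength N ↔ u.length = N := by
  induction N generalizing u with
  | zero => simp [wordsOfLength]
  | succ N ih =>
    simp only [wordsOfLength, Finset.mem_union, Finset.mem_image, ih]
    constructor
    · rintro (⟨x, rfl, rfl⟩ | ⟨x, rfl, rfl⟩) <;> simp
    · intro h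
      rcases List.eq_nil_or_concat' u with rfl | ⟨x, b, rfl⟩
      · simp at h
      · simp only [List.length_append, List.length_singleton, Nat.add_right_cancel_iff] at h
        cases b
        · exact Or.inr ⟨x, h, rfl⟩
        · exact Or.inl ⟨x, h, rfl⟩

lemma sum_wordsOfLength_succ (N : ℕ) (f : List Bool → ℝ) :
    ∑ u ∈ wordsOfLength (N + 1), f u =
      ∑ u ∈ wordsOfLength N, (f (u ++ [true]) + f (u ++ [false])) := by
  rw [wordsOfLength, Finset.sum_union, Finset.sum_image, Finset.sum_image, Finset.sum_add_distrib]
  · intro x _ y _ h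
    simpa using h
  · intro x _ y _ h
    simpa using h
  · rw [Finset.disjoint_left]
    intro u hu hu'
    obtain ⟨x, _, rfl⟩ := Finset.mem_image.1 hu
    obtain ⟨y, _, h⟩ := Finset.mem_image.1 hu'
    have := congrArg List.getLast? h
    simp at this

lemma sum_wordsOfLength_add (N n : ℕ) (f : List Bool → ℝ) :
    ∑ u ∈ wordsOfLength (N + n), f u =
      ∑ x ∈ wordsOfLength N, ∑ y ∈ wordsOfLength n, f (x ++ y) := by
  induction n generalizing f with
  | zero => simp [wordsOfLength]
  | succ n ih =>
    rw [← add_assoc, sum_wordsOfLength_succ, ih]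
    simp only [sum_wordsOfLength_succ, List.append_assoc]

lemma sum_wProb_wordsOfLength (p : ℝ) (N : ℕ) : ∑ u ∈ wordsOfLength N, wProb p u = 1 := by
  induction N with
  | zero => simp [wordsOfLength, wProb]
  | succ N ih =>
    rw [sum_wordsOfLength_succ, ← ih]
    refine Finset.sum_congr rfl fun u _ => ?_
    simp only [wProb_append]
    simp [wProb]
    ring

/-- The probability that neither `v` nor `w` occurs among the first `N` bits. -/
noncomputable def survival (v w : List Bool) (p : ℝ) (N : ℕ) : ℝ :=
  ∑ u ∈ wordsOfLength N, (avoiding v w).indicator (wProb p) u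

lemma survival_nonneg (v w : List Bool) {p : ℝ} (hp : p ∈ Set.Ioo (0 : ℝ) 1) (N : ℕ) :
    0 ≤ survival v w p N :=
  Finset.sum_nonneg fun _ _ => Set.indicator_nonneg (fun u _ => (wProb_pos hp u).le) _

lemma survival_succ_add_sum_stopWeight {v w : List Bool} (hv : v ≠ []) (hw : w ≠ [])
    (hne : v ≠ w) (hlen : v.length = w.length) (p : ℝ) (N : ℕ) :
    survival v w p (N + 1) + ∑ u ∈ wordsOfLength (N + 1), stopWeight v w p u =
      survival v w p N := by
  rw [survival, ← Finset.sum_add_distrib, sum_wordsOfLength_succ]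
  refine Finset.sum_congr rfl fun u _ => ?_
  rw [avoiding_indicator_concat hv hw hne hlen, avoiding_indicator_concat hv hw hne hlen]
  simp [wProb]
  ring

lemma survival_antitone {v w : List Bool} (hv : v ≠ []) (hw : w ≠ []) (hne : v ≠ w)
    (hlen : v.length = w.length) {p : ℝ} (hp : p ∈ Set.Ioo (0 : ℝ) 1) :
    Antitone (survival v w p) := by
  refine antitone_nat_of_succ_le fun N => ?_
  rw [← survival_succ_add_sum_stopWeight hv hw hne hlen p N, le_add_iff_nonneg_right]
  exact Finset.sum_nonneg fun _ _ => add_nonneg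
    (Set.indicator_nonneg (fun u _ => (wProb_pos hp u).le) _)
    (Set.indicator_nonneg (fun u _ => (wProb_pos hp u).le) _)

lemma survival_add_length_le (v w : List Bool) {p : ℝ} (hp : p ∈ Set.Ioo (0 : ℝ) 1) (N : ℕ) :
    survival v w p (N + v.length) ≤ survival v w p N * (1 - wProb p v) := by
  classical
  rw [survival, sum_wordsOfLength_add, survival, Finset.sum_mul]
  refine Finset.sum_le_sum fun x _ => ?_
  have hmem : v ∈ wordsOfLength v.length := mem_wordsOfLength.2 rfl
  rw [← sum_wProb_wordsOfLength p v.length, ← Finset.add_sum_erase _ _ hmem,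
    ← Finset.add_sum_erase _ (wProb p) hmem, add_sub_cancel_left]
  have h0 : (avoiding v w).indicator (wProb p) (x ++ v) = 0 :=
    Set.indicator_of_notMem (fun h => h.1 (List.suffix_append x v).isInfix) _
  rw [h0, zero_add, Finset.mul_sum]
  refine Finset.sum_le_sum fun y _ => ?_
  by_cases hxy : x ++ y ∈ avoiding v w
  · have hx : x ∈ avoiding v w :=
      ⟨fun h => hxy.1 (h.trans (List.prefix_append x y).isInfix),
        fun h => hxy.2 (h.trans (List.prefix_append x y).isInfix)⟩
    rw [Set.indicator_of_mem hxy, Set.indicator_of_mem hx, wProb_append]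
  · rw [Set.indicator_of_notMem hxy]
    exact mul_nonneg (Set.indicator_nonneg (fun u _ => (wProb_pos hp u).le) _) (wProb_pos hp y).le

lemma tendsto_survival {v w : List Bool} (hv : v ≠ []) (hw : w ≠ []) (hne : v ≠ w)
    (hlen : v.length = w.length) {p : ℝ} (hp : p ∈ Set.Ioo (0 : ℝ) 1) :
    Filter.Tendsto (survival v w p) Filter.atTop (nhds 0) := by
  have hbdd : BddBelow (Set.range (survival v w p)) :=
    ⟨0, by rintro _ ⟨N, rfl⟩; exact survival_nonneg v w hp N⟩
  have hlim := tendsto_atTop_ciInf (survival_antitone hv hw hne hlen hp) hbdd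
  set L := ⨅ N, survival v w p N
  have hL0 : 0 ≤ L := ge_of_tendsto' hlim (survival_nonneg v w hp)
  have hL : L ≤ L * (1 - wProb p v) :=
    le_of_tendsto_of_tendsto' (hlim.comp (Filter.tendsto_add_atTop_nat v.length))
      (hlim.mul_const _) (survival_add_length_le v w hp)
  have hLz : L = 0 := by
    have := wProb_pos hp v
    nlinarith
  rwa [hLz] at hlim

/-- The finite set of binary words of length less than `N`. -/
def wordsBelow (N : ℕ) : Finset (List Bool) :=
  (Finset.range N).biUnion wordsOfLength

lemma mem_wordsBelow {N : ℕ} {u : List Bool} : u ∈ wordsBelow N ↔ u.length < N := by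
  simp [wordsBelow, mem_wordsOfLength]

lemma tendsto_wordsBelow : Filter.Tendsto wordsBelow Filter.atTop Filter.atTop :=
  Filter.tendsto_atTop_finset_of_monotone
    (fun _ _ h _ hu => mem_wordsBelow.2 ((mem_wordsBelow.1 hu).trans_le h))
    fun u => ⟨u.length + 1, mem_wordsBelow.2 u.length.lt_succ_self⟩

lemma sum_stopWeight_wordsBelow {v w : List Bool} (hv : v ≠ []) (hw : w ≠ []) (hne : v ≠ w)
    (hlen : v.length = w.length) (p : ℝ) (N : ℕ) :
    ∑ u ∈ wordsBelow (N + 1), stopWeight v w p u = 1 - survival v w p N := by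
  rw [wordsBelow, Finset.sum_biUnion]
  · induction N with
    | zero =>
      have hA : ([] : List Bool) ∈ avoiding v w := by simp [avoiding, hv, hw]
      have hV : ([] : List Bool) ∉ OmegaWin v w := by simp [OmegaWin, hv]
      have hW : ([] : List Bool) ∉ OmegaWin w v := by simp [OmegaWin, hw]
      simp [wordsOfLength, survival, stopWeight, hA, hV, hW, wProb]
    | succ N ih =>
      rw [Finset.sum_range_succ, ih, ← survival_succ_add_sum_stopWeight hv hw hne hlen p N]
      ring
  · intro i _ j _ hij
    refine Finset.disjoint_left.2 fun u hi hj => hij ?_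
    rw [← mem_wordsOfLength.1 hi, mem_wordsOfLength.1 hj]

lemma summable_indicator_OmegaWin {v w : List Bool} (hv : v ≠ []) (hw : w ≠ []) (hne : v ≠ w)
    (hlen : v.length = w.length) {p : ℝ} (hp : p ∈ Set.Ioo (0 : ℝ) 1) :
    Summable ((OmegaWin v w).indicator (wProb p)) := by
  have hnn (x y u : List Bool) : 0 ≤ (OmegaWin x y).indicator (wProb p) u :=
    Set.indicator_nonneg (fun u _ => (wProb_pos hp u).le) u
  refine summable_of_sum_le (c := 1) (hnn v w) fun s => ?_
  have hs : s ⊆ wordsBelow (s.sup List.length + 1) := fun u hu =>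
    mem_wordsBelow.2 (Nat.lt_succ_of_le (Finset.le_sup (f := List.length) hu))
  calc ∑ u ∈ s, (OmegaWin v w).indicator (wProb p) u
      ≤ ∑ u ∈ wordsBelow (s.sup List.length + 1), (OmegaWin v w).indicator (wProb p) u :=
        Finset.sum_le_sum_of_subset_of_nonneg hs fun u _ _ => hnn v w u
    _ ≤ ∑ u ∈ wordsBelow (s.sup List.length + 1), stopWeight v w p u :=
        Finset.sum_le_sum fun u _ => le_add_of_nonneg_right (hnn w v u)
    _ ≤ 1 := by
        rw [sum_stopWeight_wordsBelow hv hw hne hlen]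
        linarith [survival_nonneg v w hp (s.sup List.length)]

/-- Almost surely one of `v` and `w` eventually occurs. -/
lemma Win_add_Win_swap {v w : List Bool} (hv : v ≠ []) (hw : w ≠ []) (hne : v ≠ w)
    (hlen : v.length = w.length) {p : ℝ} (hp : p ∈ Set.Ioo (0 : ℝ) 1) :
    Win v w p + Win w v p = 1 := by
  have hV := summable_indicator_OmegaWin hv hw hne hlen hp
  have hW := summable_indicator_OmegaWin hw hv hne.symm hlen.symm hp
  have hsum : HasSum (stopWeight v w p) (Win v w p + Win w v p) := by
    rw [Win, Win, tsum_subtype, tsum_subtype]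
    exact hV.hasSum.add hW.hasSum
  have h1 : Filter.Tendsto (fun N => ∑ u ∈ wordsBelow (N + 1), stopWeight v w p u)
      Filter.atTop (nhds (Win v w p + Win w v p)) :=
    hsum.comp (tendsto_wordsBelow.comp (Filter.tendsto_add_atTop_nat 1))
  have h2 := (tendsto_survival hv hw hne hlen hp).const_sub 1
  simp only [sum_stopWeight_wordsBelow hv hw hne hlen, sub_zero] at h1 h2
  exact tendsto_nhds_unique h1 h2

lemma Win_eq_tsum_OmegaStarV_mul (v w : List Bool) (p : ℝ) :
    Win v w p = (∑' x : OmegaStarV v w, wProb p x) * wProb p v := by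
  have himage : OmegaWin v w = (· ++ v) '' OmegaStarV v w := by
    ext u
    constructor
    · intro hu
      obtain ⟨x, rfl⟩ := hu.1
      exact ⟨x, hu, rfl⟩
    · rintro ⟨x, hx, rfl⟩
      exact hx
  rw [Win, himage, tsum_image (wProb p) (List.append_left_injective v).injOn, ← tsum_mul_right]
  simp only [wProb_append]

lemma wProb_mul_wProb_one_sub (p : ℝ) (u : List Bool) :
    wProb p u * wProb (1 - p) u = (p * (1 - p)) ^ u.length := by
  rw [← List.count_true_add_count_false u]
  simp only [wProb, sub_sub_cancel, pow_add, mul_pow]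
  ring

lemma Win_mul_add_of_propR {v w : List Bool} (hv : v ≠ []) (hw : w ≠ []) (hne : v ≠ w)
    (hlen : v.length = w.length) (hR : PropR v w) {p : ℝ} (hp : p ∈ Set.Ioo (0 : ℝ) 1) :
    Win v w p * (wProb p v + wProb p w) = wProb p v := by
  have h := Win_add_Win_swap hv hw hne hlen hp
  have hR' : OmegaStarV w v = OmegaStarV v w := hR.symm
  rw [Win_eq_tsum_OmegaStarV_mul w v, hR', Win_eq_tsum_OmegaStarV_mul] at h
  rw [Win_eq_tsum_OmegaStarV_mul]
  linear_combination wProb p v * h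

/-- Property `R` implies odd symmetry, and constant symmetry when `‖v‖₁ = ‖w‖₁`. -/
theorem stmt10 (v w : List Bool) (hv : v ≠ []) (hne : v ≠ w)
    (hlen : v.length = w.length) (hR : PropR v w) :
    (∀ p ∈ Set.Ioo (0:ℝ) 1, Win v w (1 - p) = 1 - Win v w p) ∧
    (v.count true = w.count true → ∀ p ∈ Set.Ioo (0:ℝ) 1, Win v w p = 1/2) := by
  have hw : w ≠ [] := by
    rintro rfl
    exact hv (List.length_eq_zero_iff.1 hlen)
  constructor
  · intro p hp
    have hq : 1 - p ∈ Set.Ioo (0 : ℝ) 1 := ⟨sub_pos.2 hp.2, sub_lt_self 1 hp.1⟩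
    have h1 := Win_mul_add_of_propR hv hw hne hlen hR hp
    have h2 := Win_mul_add_of_propR hv hw hne hlen hR hq
    have h3 : wProb p v * wProb (1 - p) v = wProb p w * wProb (1 - p) w := by
      rw [wProb_mul_wProb_one_sub, wProb_mul_wProb_one_sub, hlen]
    have pv := wProb_pos hp v
    have pw := wProb_pos hp w
    have qv := wProb_pos hq v
    have qw := wProb_pos hq w
    rw [← eq_div_iff (by positivity)] at h1 h2
    rw [h1, h2]
    field_simp
    linear_combination h3
  · intro hcount p hp
    have h := Win_mul_add_of_propR hv hw hne hlen hR hp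
    have hfalse : v.count false = w.count false := by
      have h1 := List.count_true_add_count_false v
      have h2 := List.count_true_add_count_false w
      omega
    have heq : wProb p w = wProb p v := by rw [wProb, wProb, hcount, hfalse]
    rw [heq] at h
    have pv := wProb_pos hp v
    refine mul_right_cancel₀ pv.ne' ?_
    linear_combination h / 2
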